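/- arXiv:2501.01378 — 2 statements merged into one kernel-verified Lean document; each statement's English description precedes it below -/
import Mathlib

section
/- Let $(S_n)_{n \ge 0}$ be the locally perturbed simple random walk on $\mathbb{Z}^2$: a Markov chain with $S_0 = (0,0)$ whose transition probabilities satisfy $P(S_{n+1} = S_n \pm e_i \mid S_n) = 1/4$ for $i = 1,2$ whenever $S_n \neq (0,0)$, while from the origin the chain jumps to one of the four neighbours $\pm e_1, \pm e_2$ with some fixed probabilities $p_1, p_2, p_3, p_4 \ge 0$ summing to $1$. Then $S_n/\sqrt{n}$ converges in distribution as $n \to \infty$ to the centered planar Gaussian law with covariance matrix $\frac{1}{2} I_2$, i.e. to the same limit as for the unperturbed simple symmetric random walk on $\mathbb{Z}^2$. -/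
open MeasureTheory ProbabilityTheory Filter
open scoped NNReal ENNReal Topology

/-- The four signed standard unit vectors of `ℤ²`. -/
def nbrs : Finset (ℤ × ℤ) := {(1, 0), (-1, 0), (0, 1), (0, -1)}

/-- The cylinder event that the trajectory `S` follows the history `h` up to time `n`. -/
def prefixEvent {Ω : Type*} (S : ℕ → Ω → ℤ × ℤ) (n : ℕ) (h : ℕ → ℤ × ℤ) : Set Ω :=
  {ω | ∀ k ≤ n, S k ω = h k}

/-- Embedding of `ℤ²` into `ℝ²`. -/
def embed (x : ℤ × ℤ) : ℝ × ℝ := ((x.1 : ℝ), (x.2 : ℝ))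

/-- The centered planar Gaussian measure with covariance matrix `diag (v, v)`. -/
noncomputable def gauss2 (v : ℝ≥0) : Measure (ℝ × ℝ) :=
  (gaussianReal 0 v).prod (gaussianReal 0 v)

/-- Mass function of the one-dimensional simple symmetric random walk. -/
noncomputable def srwMass : ℕ → ℤ → ℝ
  | 0, a => if a = 0 then 1 else 0
  | n + 1, a => (srwMass n (a - 1) + srwMass n (a + 1)) / 2

lemma srwMass_of_lt (n : ℕ) (a : ℤ) (ha : a < -n) : srwMass n a = 0 := by
  induction n generalizing a with
  | zero => simp [srwMass]; rintro rfl; simp at ha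
  | succ n ih =>
    push_cast at ha
    rw [srwMass, ih _ (by omega), ih _ (by omega)]; simp

lemma srwMass_of_odd (n : ℕ) (a : ℤ) (ha : Odd (n + a)) : srwMass n a = 0 := by
  induction n generalizing a with
  | zero => simp [srwMass]; rintro rfl; simp at ha
  | succ n ih =>
    obtain ⟨c, hc⟩ := ha
    push_cast at hc
    rw [srwMass, ih _ ⟨c - 1, by omega⟩, ih _ ⟨c, by omega⟩]; simp

lemma srwMass_eq_choose (n j : ℕ) : srwMass n (2 * j - n) = n.choose j / 2 ^ n := by
  induction n generalizing j with
  | zero => cases j <;> simp [srwMass]; omega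
  | succ n ih =>
    have h1 : srwMass n (2 * j - (n + 1 : ℕ) + 1) = n.choose j / 2 ^ n := by
      rw [← ih j]; congr 1; push_cast; ring
    rw [srwMass, h1]
    cases j with
    | zero =>
      rw [srwMass_of_lt _ _ (by push_cast; omega)]
      simp; ring
    | succ j =>
      have h2 : srwMass n (2 * (j + 1 : ℕ) - (n + 1 : ℕ) - 1) = n.choose j / 2 ^ n := by
        rw [← ih j]; congr 1; push_cast; ring
      rw [h2, Nat.choose_succ_succ]
      push_cast; ring

lemma sq_centralBinom_div_four_pow_le (j : ℕ) :
    ((j.centralBinom : ℝ) / 4 ^ j) ^ 2 ≤ 1 / (2 * j + 1) := by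
  induction j with
  | zero => simp
  | succ j ih =>
    have h : ((j + 1 : ℕ).centralBinom : ℝ) / 4 ^ (j + 1)
        = (2 * j + 1) / (2 * (j + 1)) * (j.centralBinom / 4 ^ j) := by
      have := congrArg (Nat.cast (R := ℝ)) (Nat.succ_mul_centralBinom_succ j)
      push_cast at this
      field_simp
      rw [pow_succ]
      linear_combination 4 ^ j * 2 * this
    rw [h, mul_pow]
    calc _ ≤ ((2 * j + 1 : ℝ) / (2 * (j + 1))) ^ 2 * (1 / (2 * j + 1)) := by gcongr
      _ ≤ _ := by
        push_cast
        rw [div_pow, div_mul_div_comm, div_le_div_iff₀ (by positivity) (by positivity)]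
        nlinarith [(Nat.cast_nonneg j : (0 : ℝ) ≤ j)]

lemma srwMass_zero_sq_le (n : ℕ) : srwMass n 0 ^ 2 ≤ ((n + 1 : ℕ) : ℝ)⁻¹ := by
  rcases Nat.even_or_odd' n with ⟨j, rfl | rfl⟩
  · have h := srwMass_eq_choose (2 * j) j
    have h0 : (2 * (j : ℤ) - (2 * j : ℕ)) = 0 := by push_cast; ring
    rw [h0, pow_mul, ← Nat.centralBinom_eq_two_mul_choose] at h
    rw [h]
    convert sq_centralBinom_div_four_pow_le j using 1
    · norm_num
    · push_cast; simp
  · rw [srwMass_of_odd _ _ ⟨j, by push_cast; ring⟩, zero_pow two_ne_zero]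
    positivity

lemma sum_srwMass_zero_sq_le (n : ℕ) :
    ∑ k ∈ Finset.range n, srwMass k 0 ^ 2 ≤ 1 + Real.log n := by
  refine (Finset.sum_le_sum fun k _ ↦ srwMass_zero_sq_le k).trans ?_
  have := harmonic_le_one_add_log n
  simpa [harmonic] using this

/-- Difference between the transition probabilities at the origin and those of the simple random
walk, extended by zero off the neighbours of the origin. -/
noncomputable def jumpDefect (q : ℤ × ℤ → ℝ) (z : ℤ × ℤ) : ℝ :=
  if z ∈ nbrs then q z - 1 / 4 else 0

lemma sum_nbrs {M : Type*} [AddCommMonoid M] (g : ℤ × ℤ → M) :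
    ∑ v ∈ nbrs, g v = g (1, 0) + (g (-1, 0) + (g (0, 1) + g (0, -1))) := by
  simp [nbrs]

lemma jumpDefect_rotation_sum {q : ℤ × ℤ → ℝ} (hq : ∑ v ∈ nbrs, q v = 1) (x y : ℤ) :
    jumpDefect q (x, y) + jumpDefect q (-y, x) + jumpDefect q (-x, -y) + jumpDefect q (y, -x)
      = 0 := by
  rw [sum_nbrs] at hq
  by_cases h : (x, y) ∈ nbrs
  · simp only [nbrs, Finset.mem_insert, Finset.mem_singleton, Prod.mk.injEq] at h
    rcases h with ⟨rfl, rfl⟩ | ⟨rfl, rfl⟩ | ⟨rfl, rfl⟩ | ⟨rfl, rfl⟩ <;>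
      norm_num [jumpDefect, nbrs] <;> linarith
  · have h' := h
    simp only [nbrs, Finset.mem_insert, Finset.mem_singleton, Prod.mk.injEq] at h'
    have h1 : (-y, x) ∉ nbrs := by simp [nbrs]; omega
    have h2 : (-x, -y) ∉ nbrs := by simp [nbrs]; omega
    have h3 : (y, -x) ∉ nbrs := by simp [nbrs]; omega
    simp [jumpDefect, h, h1, h2, h3]

/-- The one-step evolution of mass functions under the simple random walk on `ℤ²` whose jumps from
the origin have law `q`. -/
def IsPerturbedEvolution (q : ℤ × ℤ → ℝ) (m : ℕ → ℤ × ℤ → ℝ) : Prop :=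
  ∀ n z, m (n + 1) z = 1 / 4 * ∑ v ∈ nbrs, m n (z - v) + m n 0 * jumpDefect q z

/-- Averaging over rotations by right angles removes the perturbation. -/
lemma IsPerturbedEvolution.rotation_sum_eq {q : ℤ × ℤ → ℝ} {m : ℕ → ℤ × ℤ → ℝ}
    (hm : IsPerturbedEvolution q m) (hq : ∑ v ∈ nbrs, q v = 1)
    (h0 : ∀ z, m 0 z = if z = 0 then 1 else 0) (n : ℕ) (x y : ℤ) :
    m n (x, y) + m n (-y, x) + m n (-x, -y) + m n (y, -x)
      = 4 * (srwMass n (x + y) * srwMass n (x - y)) := by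
  induction n generalizing x y with
  | zero =>
    simp only [h0, srwMass, Prod.mk_eq_zero]
    by_cases h : x = 0 ∧ y = 0
    · obtain ⟨rfl, rfl⟩ := h; norm_num
    · have h1 : ¬(x + y = 0 ∧ x - y = 0) := by omega
      have h2 : ¬(-y = 0 ∧ x = 0) := by omega
      have h3 : ¬(-x = 0 ∧ -y = 0) := by omega
      have h4 : ¬(y = 0 ∧ -x = 0) := by omega
      rw [if_neg h, if_neg h2, if_neg h3, if_neg h4]
      rcases not_and_or.mp h1 with h | h <;> simp [h]
  | succ n ih =>
    simp only [hm n, sum_nbrs, srwMass, Prod.mk_sub_mk]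
    have e1 := ih (x - 1) y
    have e2 := ih (x + 1) y
    have e3 := ih x (y - 1)
    have e4 := ih x (y + 1)
    have d := jumpDefect_rotation_sum hq x y
    ring_nf at e1 e2 e3 e4 d ⊢
    linear_combination 1 / 4 * e1 + 1 / 4 * e2 + 1 / 4 * e3 + 1 / 4 * e4 + m n 0 * d

lemma IsPerturbedEvolution.apply_zero_eq {q : ℤ × ℤ → ℝ} {m : ℕ → ℤ × ℤ → ℝ}
    (hm : IsPerturbedEvolution q m) (hq : ∑ v ∈ nbrs, q v = 1)
    (h0 : ∀ z, m 0 z = if z = 0 then 1 else 0) (n : ℕ) :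
    m n 0 = srwMass n 0 ^ 2 := by
  have := hm.rotation_sum_eq hq h0 n 0 0
  simp only [neg_zero, add_zero, sub_zero, Prod.mk_zero_zero] at this
  linarith

/-- The character `z ↦ exp (i (s z₁ + t z₂))` of `ℤ²`. -/
noncomputable def latticeChar (s t : ℝ) (z : ℤ × ℤ) : ℂ :=
  Complex.exp (Complex.I * (s * z.1 + t * z.2 : ℝ))

lemma latticeChar_add (s t : ℝ) (z w : ℤ × ℤ) :
    latticeChar s t (z + w) = latticeChar s t z * latticeChar s t w := by
  rw [latticeChar, latticeChar, latticeChar, ← Complex.exp_add]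
  congr 1
  push_cast [Prod.fst_add, Prod.snd_add]
  ring

lemma norm_latticeChar (s t : ℝ) (z : ℤ × ℤ) : ‖latticeChar s t z‖ = 1 := by
  rw [latticeChar, mul_comm, Complex.norm_exp_ofReal_mul_I]

lemma sum_nbrs_latticeChar (s t : ℝ) :
    ∑ v ∈ nbrs, latticeChar s t v = 2 * (Real.cos s + Real.cos t : ℝ) := by
  rw [sum_nbrs]
  push_cast
  rw [Complex.cos, Complex.cos]
  simp only [latticeChar]
  push_cast
  ring_nf

lemma norm_latticeChar_sub_one_le (s t : ℝ) {v : ℤ × ℤ} (hv : v ∈ nbrs) :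
    ‖latticeChar s t v - 1‖ ≤ |s| + |t| := by
  refine Real.norm_exp_I_mul_ofReal_sub_one_le.trans ?_
  simp only [nbrs, Finset.mem_insert, Finset.mem_singleton] at hv
  rcases hv with rfl | rfl | rfl | rfl <;> simp

lemma norm_sum_defect_latticeChar_le {q : ℤ × ℤ → ℝ} (hq : ∑ v ∈ nbrs, q v = 1)
    (hq0 : ∀ v ∈ nbrs, 0 ≤ q v) (s t : ℝ) :
    ‖∑ v ∈ nbrs, ((q v - 1 / 4 : ℝ) : ℂ) * latticeChar s t v‖ ≤ 4 * (|s| + |t|) := by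
  have h1 : ∑ v ∈ nbrs, ((q v - 1 / 4 : ℝ) : ℂ) = 0 := by
    rw [← Complex.ofReal_sum, Finset.sum_sub_distrib, hq, sum_nbrs]
    norm_num
  have h2 : ∑ v ∈ nbrs, ((q v - 1 / 4 : ℝ) : ℂ) * latticeChar s t v
      = ∑ v ∈ nbrs, ((q v - 1 / 4 : ℝ) : ℂ) * (latticeChar s t v - 1) := by
    simp only [mul_sub, mul_one, Finset.sum_sub_distrib, h1, sub_zero]
  rw [h2]
  calc _ ≤ ∑ v ∈ nbrs, (|s| + |t|) := by
        refine norm_sum_le_of_le _ fun v hv ↦ ?_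
        have h3 : q v ≤ 1 := hq ▸ Finset.single_le_sum hq0 hv
        have h4 : ‖((q v - 1 / 4 : ℝ) : ℂ)‖ ≤ 1 := by
          rw [Complex.norm_real, Real.norm_eq_abs, abs_le]
          constructor <;> linarith [hq0 v hv]
        rw [norm_mul]
        calc _ ≤ 1 * (|s| + |t|) := by
              gcongr
              exact norm_latticeChar_sub_one_le s t hv
          _ = _ := one_mul _
    _ = _ := by rw [sum_nbrs]; ring

lemma IsPerturbedEvolution.hasSum_succ {q : ℤ × ℤ → ℝ} {m : ℕ → ℤ × ℤ → ℝ}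
    (hm : IsPerturbedEvolution q m) {n : ℕ} {s t : ℝ} {A : ℂ}
    (hA : HasSum (fun z ↦ (m n z : ℂ) * latticeChar s t z) A) :
    HasSum (fun z ↦ (m (n + 1) z : ℂ) * latticeChar s t z)
      (((Real.cos s + Real.cos t) / 2 : ℝ) * A
        + m n 0 * ∑ v ∈ nbrs, ((q v - 1 / 4 : ℝ) : ℂ) * latticeChar s t v) := by
  have h1 (v : ℤ × ℤ) : HasSum (fun z ↦ (m n (z - v) : ℂ) * latticeChar s t z)
      (latticeChar s t v * A) := by
    rw [← (Equiv.addRight v).hasSum_iff]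
    have h : (fun z ↦ (m n (z - v) : ℂ) * latticeChar s t z) ∘ Equiv.addRight v
        = fun z ↦ latticeChar s t v * ((m n z : ℂ) * latticeChar s t z) := by
      ext z
      simp only [Function.comp, Equiv.coe_addRight, add_sub_cancel_right, latticeChar_add]
      ring
    rw [h]
    exact hA.mul_left _
  have h2 : HasSum (fun z ↦ (jumpDefect q z : ℂ) * latticeChar s t z)
      (∑ v ∈ nbrs, ((q v - 1 / 4 : ℝ) : ℂ) * latticeChar s t v) := by
    have h : ∑ v ∈ nbrs, ((q v - 1 / 4 : ℝ) : ℂ) * latticeChar s t v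
        = ∑ v ∈ nbrs, (jumpDefect q v : ℂ) * latticeChar s t v :=
      Finset.sum_congr rfl fun v hv ↦ by simp [jumpDefect, hv]
    rw [h]
    exact hasSum_sum_of_ne_finset_zero fun v hv ↦ by simp [jumpDefect, hv]
  have hf : (fun z ↦ (m (n + 1) z : ℂ) * latticeChar s t z)
      = fun z ↦ 1 / 4 * ∑ v ∈ nbrs, (m n (z - v) : ℂ) * latticeChar s t z
        + m n 0 * ((jumpDefect q z : ℂ) * latticeChar s t z) := by
    ext z
    rw [hm n z, ← Finset.sum_mul]
    push_cast
    ring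
  have ha : (((Real.cos s + Real.cos t) / 2 : ℝ) : ℂ) * A
      = 1 / 4 * ∑ v ∈ nbrs, latticeChar s t v * A := by
    rw [← Finset.sum_mul, sum_nbrs_latticeChar]
    push_cast
    ring
  rw [hf, ha]
  exact ((hasSum_sum fun v _ ↦ h1 v).mul_left _).add (h2.mul_left _)

/-- The characteristic function of the perturbed walk differs from that of the simple random walk
by at most a multiple of the expected number of visits to the origin. -/
lemma IsPerturbedEvolution.exists_hasSum {q : ℤ × ℤ → ℝ} {m : ℕ → ℤ × ℤ → ℝ}
    (hm : IsPerturbedEvolution q m) (hq : ∑ v ∈ nbrs, q v = 1) (hq0 : ∀ v ∈ nbrs, 0 ≤ q v)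
    (h0 : ∀ z, m 0 z = if z = 0 then 1 else 0) (s t : ℝ) (n : ℕ) :
    ∃ A, HasSum (fun z ↦ (m n z : ℂ) * latticeChar s t z) A ∧
      ‖A - (((Real.cos s + Real.cos t) / 2 : ℝ) : ℂ) ^ n‖
        ≤ 4 * (|s| + |t|) * ∑ k ∈ Finset.range n, srwMass k 0 ^ 2 := by
  induction n with
  | zero =>
    refine ⟨1, ?_, by simp⟩
    convert hasSum_ite_eq (0 : ℤ × ℤ) (1 : ℂ) using 2 with z
    rw [h0]
    split_ifs with h <;> simp [h, latticeChar]
  | succ n ih =>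
    obtain ⟨A, hA, hle⟩ := ih
    refine ⟨_, hm.hasSum_succ hA, ?_⟩
    have hφ : ‖(((Real.cos s + Real.cos t) / 2 : ℝ) : ℂ)‖ ≤ 1 := by
      rw [Complex.norm_real, Real.norm_eq_abs, abs_le]
      constructor <;>
        linarith [Real.cos_le_one s, Real.cos_le_one t, Real.neg_one_le_cos s,
          Real.neg_one_le_cos t]
    rw [pow_succ', add_sub_right_comm, ← mul_sub, Finset.sum_range_succ, mul_add]
    refine norm_add_le_of_le ?_ ?_
    · rw [norm_mul]
      exact (mul_le_of_le_one_left (norm_nonneg _) hφ).trans hle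
    · rw [norm_mul, hm.apply_zero_eq hq h0, Complex.norm_real, Real.norm_of_nonneg (sq_nonneg _),
        mul_comm]
      gcongr
      exact norm_sum_defect_latticeChar_le hq hq0 s t

lemma tendsto_mul_cos_div_sqrt_sub_one (t : ℝ) :
    Tendsto (fun n : ℕ ↦ (n : ℝ) * (Real.cos (t / √n) - 1)) atTop (𝓝 (-(t ^ 2 / 2))) := by
  rw [tendsto_iff_norm_sub_tendsto_zero]
  have hlim : Tendsto (fun n : ℕ ↦ t ^ 4 * (5 / 96) / (n : ℝ)) atTop (𝓝 0) :=
    tendsto_const_div_atTop_nhds_zero_nat _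
  refine squeeze_zero' (.of_forall fun _ ↦ norm_nonneg _) ?_ hlim
  filter_upwards [eventually_gt_atTop 0,
    tendsto_natCast_atTop_atTop.eventually_ge_atTop (t ^ 2)] with n hn hnt
  have hn' : (0 : ℝ) < n := by exact_mod_cast hn
  have hs : √(n : ℝ) ^ 2 = n := Real.sq_sqrt hn'.le
  have h2 : (t / √(n : ℝ)) ^ 2 = t ^ 2 / n := by rw [div_pow, hs]
  have h4 : |t / √(n : ℝ)| ^ 4 = t ^ 4 / n ^ 2 := by
    rw [(by decide : Even 4).pow_abs, show 4 = 2 * 2 from rfl, pow_mul, h2, div_pow, ← pow_mul]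
  have hx : |t / √(n : ℝ)| ≤ 1 := by
    rw [← sq_le_one_iff_abs_le_one, h2]
    exact div_le_one_of_le₀ hnt hn'.le
  have h := Real.cos_bound hx
  rw [h2, h4] at h
  have h5 : (n : ℝ) * (Real.cos (t / √n) - 1) - -(t ^ 2 / 2)
      = n * (Real.cos (t / √n) - (1 - t ^ 2 / n / 2)) := by
    field_simp
    ring
  rw [h5, Real.norm_eq_abs, abs_mul, abs_of_pos hn']
  calc _ ≤ (n : ℝ) * (t ^ 4 / n ^ 2 * (5 / 96)) := by gcongr
    _ = _ := by field_simp

lemma tendsto_half_cos_add_cos_pow (s t : ℝ) :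
    Tendsto (fun n : ℕ ↦ ((Real.cos (s / √n) + Real.cos (t / √n)) / 2) ^ n) atTop
      (𝓝 (Real.exp (-(s ^ 2 / 4) - t ^ 2 / 4))) := by
  have h : Tendsto (fun n : ℕ ↦ (n : ℝ) * ((Real.cos (s / √n) + Real.cos (t / √n)) / 2 - 1)) atTop
      (𝓝 (-(s ^ 2 / 4) - t ^ 2 / 4)) := by
    convert ((tendsto_mul_cos_div_sqrt_sub_one s).add
      (tendsto_mul_cos_div_sqrt_sub_one t)).div_const 2 using 2
    · ring
    · ring
  simpa using Real.tendsto_one_add_pow_exp_of_tendsto h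

lemma tendsto_visit_bound (s t : ℝ) :
    Tendsto (fun n : ℕ ↦ 4 * (|s / √n| + |t / √n|) * ∑ k ∈ Finset.range n, srwMass k 0 ^ 2)
      atTop (𝓝 0) := by
  have hlog : Tendsto (fun n : ℕ ↦ (1 + Real.log n) / √n) atTop (𝓝 0) := by
    have h1 : Tendsto (fun n : ℕ ↦ Real.log n / √n) atTop (𝓝 0) := by
      simp only [Real.sqrt_eq_rpow]
      exact (isLittleO_log_rpow_atTop (r := 1 / 2) (by norm_num)).tendsto_div_nhds_zero.comp
        tendsto_natCast_atTop_atTop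
    have h2 : Tendsto (fun n : ℕ ↦ 1 / √(n : ℝ)) atTop (𝓝 0) := by
      simpa [Function.comp_def] using tendsto_inv_atTop_zero.comp
        (Real.tendsto_sqrt_atTop.comp tendsto_natCast_atTop_atTop)
    simpa [add_div] using h2.add h1
  refine squeeze_zero (fun n ↦ by positivity) (fun n ↦ ?_)
    (by simpa using hlog.const_mul (4 * (|s| + |t|)))
  rw [abs_div, abs_div, abs_of_nonneg (Real.sqrt_nonneg _), ← add_div]
  calc _ ≤ 4 * ((|s| + |t|) / √n) * (1 + Real.log n) := by
        gcongr
        exact sum_srwMass_zero_sq_le n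
    _ = _ := by ring

section OneStep

variable {Ω : Type*} [MeasurableSpace Ω] {P : Measure Ω} {S : ℕ → Ω → ℤ × ℤ}

/-- A one-step transition rule given each full history implies the rule given the present state. -/
lemma measure_step_inter_eq (hmeas : ∀ n, Measurable (S n)) {n : ℕ} {x v : ℤ × ℤ} {c : ℝ≥0∞}
    (hstep : ∀ h : ℕ → ℤ × ℤ, h n = x →
      P ({ω | S (n + 1) ω = h n + v} ∩ prefixEvent S n h) = c * P (prefixEvent S n h)) :
    P ({ω | S (n + 1) ω = x + v} ∩ {ω | S n ω = x}) = c * P {ω | S n ω = x} := by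
  let H : Ω → Fin (n + 1) → ℤ × ℤ := fun ω k ↦ S k ω
  have hH : Measurable H := measurable_pi_lambda _ fun k ↦ hmeas k
  let T : Set (Fin (n + 1) → ℤ × ℤ) := {g | g (Fin.last n) = x}
  have hT : {ω | S n ω = x} = H ⁻¹' T := by
    ext ω
    simp [H, T]
  have hB : MeasurableSet {ω | S (n + 1) ω = x + v} :=
    hmeas (n + 1) (measurableSet_singleton (x + v))
  have hpre (g : T) : P ({ω | S (n + 1) ω = x + v} ∩ H ⁻¹' {g.1}) = c * P (H ⁻¹' {g.1}) := by
    let h : ℕ → ℤ × ℤ := fun k ↦ if hk : k < n + 1 then g.1 ⟨k, hk⟩ else 0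
    have hn : h n = x := by
      rw [← show g.1 (Fin.last n) = x from g.2]
      simp [h, Fin.last]
    have heq : H ⁻¹' {g.1} = prefixEvent S n h := by
      ext ω
      simp only [Set.mem_preimage, Set.mem_singleton_iff, prefixEvent, Set.mem_ofPred_eq,
        funext_iff]
      constructor
      · intro hω k hk
        simp only [h, Nat.lt_succ_of_le hk, dif_pos]
        exact hω ⟨k, Nat.lt_succ_of_le hk⟩
      · intro hω k
        have := hω k (Nat.le_of_lt_succ k.2)
        simpa [h, H, Nat.le_of_lt_succ k.2] using this
    rw [heq, ← hstep h hn, hn]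
  have hsing (g) (_ : g ∈ T) : MeasurableSet (H ⁻¹' {g}) := hH (measurableSet_singleton g)
  have hr := tsum_measure_preimage_singleton (μ := P.restrict {ω | S (n + 1) ω = x + v})
    T.to_countable hsing
  rw [Measure.restrict_apply (hH T.to_countable.measurableSet)] at hr
  rw [hT, Set.inter_comm, ← hr, ← tsum_measure_preimage_singleton T.to_countable hsing,
    ← ENNReal.tsum_mul_left]
  refine tsum_congr fun g ↦ ?_
  rw [Measure.restrict_apply (hsing _ g.2), Set.inter_comm, hpre]

lemma measure_nonneighbour_step_eq_zero [IsFiniteMeasure P] (hmeas : ∀ n, Measurable (S n))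
    {c : ℤ × ℤ → ℤ × ℤ → ℝ≥0∞} (hc : ∀ x, ∑ v ∈ nbrs, c x v = 1)
    (hstep : ∀ n x, ∀ v ∈ nbrs,
      P ({ω | S (n + 1) ω = x + v} ∩ {ω | S n ω = x}) = c x v * P {ω | S n ω = x})
    (n : ℕ) {x y : ℤ × ℤ} (hxy : y - x ∉ nbrs) :
    P ({ω | S (n + 1) ω = y} ∩ {ω | S n ω = x}) = 0 := by
  let D : Ω → ℤ × ℤ := fun ω ↦ S (n + 1) ω - S n ω
  have hD : Measurable D := (hmeas (n + 1)).sub (hmeas n)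
  have hA : MeasurableSet {ω | S n ω = x} := hmeas n (measurableSet_singleton x)
  have hfull : P.restrict {ω | S n ω = x} (D ⁻¹' nbrs) = P.restrict {ω | S n ω = x} Set.univ := by
    rw [← sum_measure_preimage_singleton nbrs fun v _ ↦ hD (measurableSet_singleton v),
      Measure.restrict_apply_univ, ← one_mul (P _), ← hc x, Finset.sum_mul]
    refine Finset.sum_congr rfl fun v hv ↦ ?_
    rw [← hstep n x v hv, Measure.restrict_apply (hD (measurableSet_singleton v))]
    congr 1
    ext ω
    simp only [D, Set.mem_inter_iff, Set.mem_preimage, Set.mem_singleton_iff, Set.mem_ofPred_eq]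
    refine and_congr_left fun h ↦ ?_
    rw [h, sub_eq_iff_eq_add']
  have hnull : P.restrict {ω | S n ω = x} (D ⁻¹' nbrs)ᶜ = 0 := by
    rw [measure_compl (hD nbrs.measurableSet) (measure_ne_top _ _), hfull, tsub_self]
  rw [Measure.restrict_apply (hD nbrs.measurableSet).compl] at hnull
  refine measure_mono_null ?_ hnull
  rintro ω ⟨h1, h2⟩
  refine ⟨?_, h2⟩
  simp only [Set.mem_ofPred_eq] at h1 h2
  simpa [D, h1, h2] using hxy

lemma measure_succ_eq_sum [IsFiniteMeasure P] (hmeas : ∀ n, Measurable (S n))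
    {c : ℤ × ℤ → ℤ × ℤ → ℝ≥0∞} (hc : ∀ x, ∑ v ∈ nbrs, c x v = 1)
    (hstep : ∀ n x, ∀ v ∈ nbrs,
      P ({ω | S (n + 1) ω = x + v} ∩ {ω | S n ω = x}) = c x v * P {ω | S n ω = x})
    (n : ℕ) (y : ℤ × ℤ) :
    P {ω | S (n + 1) ω = y} = ∑ v ∈ nbrs, c (y - v) v * P {ω | S n ω = y - v} := by
  have hB : MeasurableSet {ω | S (n + 1) ω = y} := hmeas (n + 1) (measurableSet_singleton y)
  have hr := tsum_measure_preimage_singleton (μ := P.restrict {ω | S (n + 1) ω = y})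
    (Set.univ : Set (ℤ × ℤ)).to_countable (f := S n) fun x _ ↦ hmeas n (measurableSet_singleton x)
  rw [tsum_univ fun x ↦ P.restrict {ω | S (n + 1) ω = y} (S n ⁻¹' {x}), Set.preimage_univ,
    Measure.restrict_apply_univ, ← (Equiv.subLeft y).tsum_eq, tsum_eq_sum (s := nbrs)] at hr
  · rw [← hr]
    refine Finset.sum_congr rfl fun v hv ↦ ?_
    rw [Measure.restrict_apply (hmeas n (measurableSet_singleton _)), ← hstep n _ v hv,
      Set.inter_comm, sub_add_cancel]
    rfl
  · intro v hv
    rw [Measure.restrict_apply (hmeas n (measurableSet_singleton _)), Set.inter_comm]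
    exact measure_nonneighbour_step_eq_zero hmeas hc hstep n (by simpa using hv)

lemma isPerturbedEvolution_measureReal [IsFiniteMeasure P] (hmeas : ∀ n, Measurable (S n))
    {p : ℤ × ℤ → ℝ≥0∞} (hp : ∑ v ∈ nbrs, p v = 1)
    (hstep : ∀ n x, ∀ v ∈ nbrs, P ({ω | S (n + 1) ω = x + v} ∩ {ω | S n ω = x})
      = (if x = 0 then p v else 1 / 4) * P {ω | S n ω = x}) :
    IsPerturbedEvolution (fun v ↦ (p v).toReal) (fun n z ↦ P.real {ω | S n ω = z}) := by
  intro n y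
  have hc (x : ℤ × ℤ) : ∑ v ∈ nbrs, (if x = 0 then p v else (1 / 4 : ℝ≥0∞)) = 1 := by
    split_ifs
    · exact hp
    · rw [Finset.sum_const, show nbrs.card = 4 from rfl, nsmul_eq_mul, Nat.cast_ofNat, one_div]
      exact ENNReal.mul_inv_cancel (by norm_num) (by norm_num)
  have hfin (v) (hv : v ∈ nbrs) : p v ≠ ∞ :=
    ENNReal.sum_ne_top.mp (hp ▸ ENNReal.one_ne_top) v hv
  simp only [Measure.real]
  rw [measure_succ_eq_sum hmeas hc hstep n y, ENNReal.toReal_sum]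
  · have hterm (v) : ((if y - v = 0 then p v else 1 / 4) * P {ω | S n ω = y - v}).toReal
        = 1 / 4 * (P {ω | S n ω = y - v}).toReal
          + if y = v then (P {ω | S n ω = 0}).toReal * ((p v).toReal - 1 / 4) else 0 := by
      rw [ENNReal.toReal_mul]
      by_cases h : y = v
      · simp only [h, sub_self, if_true]
        ring
      · simp [h, sub_eq_zero]
    simp only [hterm, Finset.sum_add_distrib, ← Finset.mul_sum, Finset.sum_ite_eq, jumpDefect,
      mul_ite, mul_zero]
  · intro v hv
    refine ENNReal.mul_ne_top ?_ (measure_ne_top _ _)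
    split_ifs
    · exact hfin v hv
    · norm_num

end OneStep

lemma measurable_scaled_embed {Ω : Type*} [MeasurableSpace Ω] {X : Ω → ℤ × ℤ}
    (hX : Measurable X) (r : ℝ) : Measurable fun ω ↦ WithLp.toLp 2 (r⁻¹ • embed (X ω)) :=
  (Measurable.of_discrete (f := fun z ↦ WithLp.toLp 2 (r⁻¹ • embed z))).comp hX

/-- **CLT for perturbed evolutions of mass functions**, at the level of characteristic functions. -/
lemma tendsto_integral_latticeChar {Ω : Type*} [MeasurableSpace Ω] {P : Measure Ω}
    [IsFiniteMeasure P] {S : ℕ → Ω → ℤ × ℤ} (hmeas : ∀ n, Measurable (S n)) {q : ℤ × ℤ → ℝ}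
    (hm : IsPerturbedEvolution q fun n z ↦ P.real {ω | S n ω = z})
    (hq : ∑ v ∈ nbrs, q v = 1) (hq0 : ∀ v ∈ nbrs, 0 ≤ q v)
    (h0 : ∀ z, P.real {ω | S 0 ω = z} = if z = 0 then 1 else 0) (s t : ℝ) :
    Tendsto (fun n : ℕ ↦ ∫ ω, latticeChar (s / √n) (t / √n) (S n ω) ∂P) atTop
      (𝓝 (Real.exp (-(s ^ 2 / 4) - t ^ 2 / 4) : ℂ)) := by
  have hint (n : ℕ) (a b : ℝ) : ‖(∫ ω, latticeChar a b (S n ω) ∂P)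
      - (((Real.cos a + Real.cos b) / 2 : ℝ) : ℂ) ^ n‖
        ≤ 4 * (|a| + |b|) * ∑ k ∈ Finset.range n, srwMass k 0 ^ 2 := by
    obtain ⟨A, hA, hle⟩ := hm.exists_hasSum hq hq0 h0 a b n
    have hsm : AEStronglyMeasurable (latticeChar a b) (P.map (S n)) :=
      Measurable.aestronglyMeasurable .of_discrete
    have hi : Integrable (latticeChar a b) (P.map (S n)) :=
      (integrable_const (1 : ℝ)).mono' hsm (.of_forall fun z ↦ (norm_latticeChar a b z).le)
    rw [← integral_map (hmeas n).aemeasurable hsm, integral_countable hi]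
    convert hle using 3
    rw [← hA.tsum_eq]
    refine tsum_congr fun z ↦ ?_
    rw [map_measureReal_apply (hmeas n) (measurableSet_singleton z), Complex.real_smul]
    rfl
  have h1 := squeeze_zero_norm (fun n : ℕ ↦ hint n (s / √n) (t / √n)) (tendsto_visit_bound s t)
  have h2 := (Complex.continuous_ofReal.tendsto _).comp (tendsto_half_cos_add_cos_pow s t)
  simpa [Function.comp_def] using h1.add h2

lemma charFun_gauss2 (t : WithLp 2 (ℝ × ℝ)) :
    charFun ((gauss2 (1 / 2)).map (WithLp.toLp 2)) t
      = (Real.exp (-((WithLp.ofLp t).1 ^ 2 / 4) - (WithLp.ofLp t).2 ^ 2 / 4) : ℂ) := by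
  rw [gauss2, charFun_prod, charFun_gaussianReal, charFun_gaussianReal, ← Complex.exp_add,
    Complex.ofReal_exp]
  congr 1
  push_cast
  ring

lemma charFun_scaled_embed {Ω : Type*} [MeasurableSpace Ω] {P : Measure Ω} {X : Ω → ℤ × ℤ}
    (hX : Measurable X) (r : ℝ) (t : WithLp 2 (ℝ × ℝ)) :
    charFun (P.map fun ω ↦ WithLp.toLp 2 (r⁻¹ • embed (X ω))) t
      = ∫ ω, latticeChar ((WithLp.ofLp t).1 / r) ((WithLp.ofLp t).2 / r) (X ω) ∂P := by
  rw [charFun_apply, integral_map (measurable_scaled_embed hX r).aemeasurable (by fun_prop)]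
  refine integral_congr_ae (.of_forall fun ω ↦ ?_)
  simp only [latticeChar, WithLp.prod_inner_apply, embed, Prod.smul_mk, smul_eq_mul,
    RCLike.inner_apply, conj_trivial]
  congr 1
  push_cast
  ring

/-- **CLT for the locally perturbed simple random walk on `ℤ²`.**
`S` is a Markov chain started at the origin which jumps to each of the four
nearest neighbours with probability `1/4` from every non-origin site, and from
the origin jumps to the four neighbours with arbitrary fixed probabilities `p v`
summing to `1`.  Then `S n / √n` converges in distribution to the centered
planar Gaussian law with covariance matrix `(1/2) I₂` — the same limit as for
the unperturbed simple symmetric random walk. -/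
theorem locally_perturbed_ssrw_clt
    {Ω : Type*} [MeasurableSpace Ω] (P : Measure Ω) [IsProbabilityMeasure P]
    (S : ℕ → Ω → ℤ × ℤ)
    (hmeas : ∀ n, Measurable (S n))
    (hS0 : ∀ᵐ ω ∂P, S 0 ω = (0, 0))
    (p : ℤ × ℤ → ℝ≥0∞) (hp : ∑ v ∈ nbrs, p v = 1)
    (hMarkov : ∀ (n : ℕ) (h : ℕ → ℤ × ℤ), h n ≠ (0, 0) → ∀ v ∈ nbrs,
      P ({ω | S (n + 1) ω = h n + v} ∩ prefixEvent S n h)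
        = (1/4) * P (prefixEvent S n h))
    (hOrigin : ∀ (n : ℕ) (h : ℕ → ℤ × ℤ), h n = (0, 0) → ∀ v ∈ nbrs,
      P ({ω | S (n + 1) ω = h n + v} ∩ prefixEvent S n h)
        = p v * P (prefixEvent S n h)) :
    ∀ f : BoundedContinuousFunction (ℝ × ℝ) ℝ,
      Tendsto (fun n : ℕ => ∫ ω, f ((Real.sqrt n)⁻¹ • embed (S n ω)) ∂P) atTop
        (𝓝 (∫ x, f x ∂(gauss2 (1/2)))) := by
  have hstep (n : ℕ) (x v : ℤ × ℤ) (hv : v ∈ nbrs) :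
      P ({ω | S (n + 1) ω = x + v} ∩ {ω | S n ω = x})
        = (if x = 0 then p v else 1 / 4) * P {ω | S n ω = x} := by
    refine measure_step_inter_eq hmeas fun h hn ↦ ?_
    split_ifs with hx
    · exact hOrigin n h (hn.trans hx) v hv
    · exact hMarkov n h (fun h0 ↦ hx (hn.symm.trans h0)) v hv
  have hm := isPerturbedEvolution_measureReal hmeas hp hstep
  have hq : ∑ v ∈ nbrs, (p v).toReal = 1 := by
    rw [← ENNReal.toReal_sum (ENNReal.sum_ne_top.mp (hp ▸ ENNReal.one_ne_top)), hp,
      ENNReal.toReal_one]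
  have h0 (z : ℤ × ℤ) : P.real {ω | S 0 ω = z} = if z = 0 then 1 else 0 := by
    split_ifs with hz
    · have : P {ω | S 0 ω = z} = 1 := by
        rw [hz]
        exact mem_ae_iff_prob_eq_one (hmeas 0 (measurableSet_singleton 0)) |>.mp hS0
      simp [Measure.real, this]
    · have : P {ω | S 0 ω = z} = 0 := by
        have hnull : P {ω | ¬S 0 ω = (0, 0)} = 0 := ae_iff.mp hS0
        exact measure_mono_null (fun ω hω h ↦ hz ((Eq.symm hω).trans h)) hnull
      simp [Measure.real, this]
  have hX (n : ℕ) := measurable_scaled_embed (hmeas n) √n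
  have : IsProbabilityMeasure (gauss2 (1 / 2)) := by
    unfold gauss2
    infer_instance
  let μ (n : ℕ) : ProbabilityMeasure (WithLp 2 (ℝ × ℝ)) :=
    ⟨P.map fun ω ↦ WithLp.toLp 2 ((√n)⁻¹ • embed (S n ω)),
      Measure.isProbabilityMeasure_map (hX n).aemeasurable⟩
  let μ₀ : ProbabilityMeasure (WithLp 2 (ℝ × ℝ)) :=
    ⟨(gauss2 (1 / 2)).map (WithLp.toLp 2),
      Measure.isProbabilityMeasure_map (WithLp.measurable_toLp 2 _).aemeasurable⟩
  have hlim : Tendsto μ atTop (𝓝 μ₀) := by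
    refine ProbabilityMeasure.tendsto_of_tendsto_charFun fun t ↦ ?_
    simp only [μ, μ₀, ProbabilityMeasure.coe_mk, charFun_gauss2,
      charFun_scaled_embed (hmeas _)]
    exact tendsto_integral_latticeChar hmeas hm hq (fun _ _ ↦ ENNReal.toReal_nonneg) h0 _ _
  intro f
  let g := f.compContinuous ⟨WithLp.ofLp, WithLp.prod_continuous_ofLp 2 ℝ ℝ⟩
  have hg := ProbabilityMeasure.tendsto_iff_forall_integral_tendsto.mp hlim g
  simp only [μ, μ₀, ProbabilityMeasure.coe_mk] at hg
  rw [integral_map (WithLp.measurable_toLp 2 _).aemeasurable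
    g.continuous.aestronglyMeasurable] at hg
  simp_rw [integral_map (hX _).aemeasurable g.continuous.aestronglyMeasurable] at hg
  exact hg
end

section
/- Let $\mu$ be a probability distribution on $\mathbb{Z}^2$ with bounded support, mean zero, and nondegenerate (invertible) covariance matrix $\Sigma$, whose support generates $\mathbb{Z}^2$ as a group. Let $A \subset \mathbb{Z}^2$ be a finite set and let $(S_n)_{n \ge 0}$ be a Markov chain on $\mathbb{Z}^2$ with $S_0 = 0$ such that $P(S_{n+1} = y \mid S_n = x) = \mu(y - x)$ for all $x \notin A$, while for $x \in A$ the transition probabilities are arbitrary subject to: there exist $R < \infty$ and $\delta > 0$ such that from every $x \in A$ the jumps are bounded by $R$ in norm and every nonzero transition probability from $x$ is at least $\delta$, and the support of $\mu$ is contained in the support of the transition law from every $x \in A$. Then the locally perturbed random walk $(S_n)$ is recurrent: almost surely $S_n = (0,0)$ for infinitely many $n$. -/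
open MeasureTheory ProbabilityTheory Filter
open scoped NNReal ENNReal Topology

/-- The coordinate functions of `ℤ²`, as real-valued functions. -/
def coordRV (i : Fin 2) (x : ℤ × ℤ) : ℝ := if i = 0 then (x.1 : ℝ) else (x.2 : ℝ)

/-- A positively weighted balanced finite set of integer points has a positive integer relation. -/
lemma exists_nat_relation (F : Finset (ℤ × ℤ)) (m : ℤ × ℤ → ℝ) (hm : ∀ z ∈ F, 0 < m z)
    (h1 : ∑ z ∈ F, m z * (z.1 : ℝ) = 0) (h2 : ∑ z ∈ F, m z * (z.2 : ℝ) = 0) :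
    ∃ n : ℤ × ℤ → ℕ, (∀ z ∈ F, 1 ≤ n z) ∧ ∑ z ∈ F, n z • z = 0 := by
  set v : ℕ → ℤ × ℤ := fun N => ∑ z ∈ F, ⌊(N : ℝ) * m z⌋₊ • z with hv
  have bound : ∀ (g : ℤ × ℤ → ℤ), ∑ z ∈ F, m z * (g z : ℝ) = 0 → ∀ N : ℕ,
      |∑ z ∈ F, (⌊(N : ℝ) * m z⌋₊ : ℤ) * g z| ≤ ∑ z ∈ F, |g z| := by
    intro g hg N
    have key : (∑ z ∈ F, (⌊(N : ℝ) * m z⌋₊ : ℝ) * (g z : ℝ))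
        = ∑ z ∈ F, ((⌊(N : ℝ) * m z⌋₊ : ℝ) - N * m z) * (g z : ℝ) := by
      have : ∑ z ∈ F, (N : ℝ) * (m z * (g z : ℝ)) = 0 := by
        rw [← Finset.mul_sum, hg, mul_zero]
      rw [← sub_zero (∑ z ∈ F, (⌊(N : ℝ) * m z⌋₊ : ℝ) * (g z : ℝ)), ← this,
        ← Finset.sum_sub_distrib]
      exact Finset.sum_congr rfl fun z _ => by ring
    have : |∑ z ∈ F, (⌊(N : ℝ) * m z⌋₊ : ℝ) * (g z : ℝ)| ≤ ∑ z ∈ F, |(g z : ℝ)| := by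
      rw [key]
      refine (Finset.abs_sum_le_sum_abs _ _).trans (Finset.sum_le_sum fun z hz => ?_)
      rw [abs_mul]
      refine mul_le_of_le_one_left (abs_nonneg _) ?_
      have hnn : 0 ≤ (N : ℝ) * m z := mul_nonneg (Nat.cast_nonneg _) (hm z hz).le
      rw [abs_le]
      constructor
      · linarith [(Nat.lt_floor_add_one ((N : ℝ) * m z))]
      · linarith [Nat.floor_le hnn]
    exact_mod_cast this
  have hfin : ∀ N, v N ∈ Finset.Icc (-∑ z ∈ F, |z.1|) (∑ z ∈ F, |z.1|) ×ˢ
      Finset.Icc (-∑ z ∈ F, |z.2|) (∑ z ∈ F, |z.2|) := by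
    intro N
    have e1 := bound Prod.fst h1 N
    have e2 := bound Prod.snd h2 N
    rw [abs_le] at e1 e2
    simpa [Finset.mem_product, Finset.mem_Icc, hv, Prod.fst_sum, Prod.snd_sum] using
      And.intro e1 e2
  obtain ⟨c, hc⟩ : ∃ c, ∃ᶠ N in atTop, v N = c := by
    by_contra hcon
    simp only [not_exists, not_frequently] at hcon
    have := (Finset.eventually_all (l := atTop) (Finset.Icc (-∑ z ∈ F, |z.1|) (∑ z ∈ F, |z.1|) ×ˢ
      Finset.Icc (-∑ z ∈ F, |z.2|) (∑ z ∈ F, |z.2|)) (p := fun c N => ¬ v N = c)).2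
      fun c _ => hcon c
    obtain ⟨N, hN⟩ := this.exists
    exact hN _ (hfin N) rfl
  obtain ⟨M, hM⟩ := hc.exists
  have hbig : ∀ᶠ N : ℕ in atTop, ∀ z ∈ F, ⌊(M : ℝ) * m z⌋₊ + 1 ≤ ⌊(N : ℝ) * m z⌋₊ := by
    rw [Finset.eventually_all]
    intro z hz
    have : Tendsto (fun N : ℕ => ⌊(N : ℝ) * m z⌋₊) atTop atTop :=
      tendsto_nat_floor_atTop.comp
        (tendsto_natCast_atTop_atTop.atTop_mul_const (hm z hz))
    exact this.eventually_ge_atTop _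
  obtain ⟨N, hN, hN'⟩ := (hc.and_eventually hbig).exists
  refine ⟨fun z => ⌊(N : ℝ) * m z⌋₊ - ⌊(M : ℝ) * m z⌋₊, fun z hz => ?_, ?_⟩
  · have := hN' z hz
    exact Nat.le_sub_of_add_le (by omega)
  · have : v N = ∑ z ∈ F, (⌊(N : ℝ) * m z⌋₊ - ⌊(M : ℝ) * m z⌋₊) • z + v M := by
      rw [hv, ← Finset.sum_add_distrib]
      refine Finset.sum_congr rfl fun z hz => ?_
      rw [← add_nsmul, Nat.sub_add_cancel (by have := hN' z hz; omega)]
    rw [hN, hM] at this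
    simpa using this.symm

/-- A positively weighted balanced finite set generating `ℤ²` as a group generates it as a
monoid. -/
lemma addSubmonoid_closure_eq_top (F : Finset (ℤ × ℤ)) (m : ℤ × ℤ → ℝ) (hm : ∀ z ∈ F, 0 < m z)
    (h1 : ∑ z ∈ F, m z * (z.1 : ℝ) = 0) (h2 : ∑ z ∈ F, m z * (z.2 : ℝ) = 0)
    (hgen : AddSubgroup.closure (F : Set (ℤ × ℤ)) = ⊤) :
    AddSubmonoid.closure (F : Set (ℤ × ℤ)) = ⊤ := by
  classical
  obtain ⟨n, hn, hn0⟩ := exists_nat_relation F m hm h1 h2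
  have hneg : ∀ z ∈ F, -z ∈ AddSubmonoid.closure (F : Set (ℤ × ℤ)) := by
    intro z hz
    have : -z = (n z - 1) • z + ∑ y ∈ F.erase z, n y • y := by
      rw [← Finset.add_sum_erase F _ hz] at hn0
      have e : n z • z = (n z - 1) • z + z := by
        rw [← succ_nsmul, Nat.sub_add_cancel (hn z hz)]
      rw [e] at hn0
      rw [neg_eq_iff_add_eq_zero, ← hn0]
      abel
    rw [this]
    refine add_mem (nsmul_mem (AddSubmonoid.subset_closure hz) _) (sum_mem fun y hy => ?_)
    exact nsmul_mem (AddSubmonoid.subset_closure (Finset.mem_of_mem_erase hy)) _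
  rw [eq_top_iff]
  rintro x -
  have hx : x ∈ AddSubgroup.closure (F : Set (ℤ × ℤ)) := by rw [hgen]; trivial
  rw [← AddSubgroup.mem_toAddSubmonoid, AddSubgroup.closure_toAddSubmonoid] at hx
  refine AddSubmonoid.closure_le.2 ?_ hx
  rintro y (hy | hy)
  · exact AddSubmonoid.subset_closure hy
  · simpa using hneg (-y) hy

/-- Propagation of a maximum: a function bounded by `c`, attaining `c`, and subharmonic off `B`
attains `c` on `B` if `B` can be reached. -/
lemma exists_mem_eq_of_subharmonic {X : Type*} {p : X → X → ℝ} {F : X → Finset X}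
    (hp : ∀ x y, 0 ≤ p x y) (hF : ∀ x y, 0 < p x y → y ∈ F x) (hsum : ∀ x, ∑ y ∈ F x, p x y = 1)
    {B : Set X} {f : X → ℝ} {c : ℝ} (hf : ∀ x ∉ B, f x ≤ ∑ y ∈ F x, p x y * f y)
    (hc : ∀ x, f x ≤ c) {x o : X} (ho : o ∈ B)
    (hx : Relation.ReflTransGen (fun a b => 0 < p a b) x o) (hxc : f x = c) :
    ∃ b ∈ B, f b = c := by
  induction hx using Relation.ReflTransGen.head_induction_on with
  | refl => exact ⟨o, ho, hxc⟩
  | head hab hb ih =>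
    rename_i a b
    by_cases ha : a ∈ B
    · exact ⟨a, ha, hxc⟩
    · refine ih (le_antisymm (hc _) ?_)
      by_contra! hlt
      have : ∑ y ∈ F a, p a y * f y < ∑ y ∈ F a, p a y * c :=
        Finset.sum_lt_sum (fun y _ => mul_le_mul_of_nonneg_left (hc y) (hp a y))
          ⟨b, hF _ _ hab, mul_lt_mul_of_pos_left hlt hab⟩
      rw [← Finset.sum_mul, hsum, one_mul] at this
      linarith [hf a ha]

/-- A bounded function which vanishes at `o` and is harmonic elsewhere is nonpositive, if there is a
function with finite sublevel sets which is superharmonic off a finite set. -/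
lemma nonpos_of_harmonic_off {X : Type*} {p : X → X → ℝ} {F : X → Finset X}
    (hp : ∀ x y, 0 ≤ p x y) (hF : ∀ x y, 0 < p x y → y ∈ F x) (hsum : ∀ x, ∑ y ∈ F x, p x y = 1)
    {o : X} (hreach : ∀ x, Relation.ReflTransGen (fun a b => 0 < p a b) x o)
    {V : X → ℝ} (hV : ∀ c, {x | V x ≤ c}.Finite) {B : Set X} (hB : B.Finite)
    (hVB : ∀ x ∉ B, ∑ y ∈ F x, p x y * V y ≤ V x)
    {w : X → ℝ} (hw1 : ∀ x, w x ≤ 1) (hwo : w o = 0)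
    (hw : ∀ x, x ≠ o → w x = ∑ y ∈ F x, p x y * w y) (x : X) : w x ≤ 0 := by
  have hB' : (insert o B).Finite := hB.insert o
  obtain ⟨b, -, hb⟩ := Set.exists_max_image (insert o B) w hB' ⟨o, Set.mem_insert _ _⟩
  obtain ⟨d, -, hd⟩ := Set.exists_min_image (insert o B) V hB' ⟨o, Set.mem_insert _ _⟩
  have main : ∀ ε > 0, ∀ x, w x ≤ w b + ε * (V x - V d) := by
    intro ε hε x
    set f : X → ℝ := fun y => w y - ε * V y with hf
    have hxmem : V x ≤ V x + (1 - w x) / ε :=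
      le_add_of_nonneg_right (div_nonneg (by linarith [hw1 x]) hε.le)
    obtain ⟨t, -, ht⟩ := Set.exists_max_image {y | V y ≤ V x + (1 - w x) / ε} f (hV _)
      ⟨x, hxmem⟩
    have htop : ∀ y, f y ≤ f t := by
      intro y
      by_cases hy : V y ≤ V x + (1 - w x) / ε
      · exact ht y hy
      · refine le_trans ?_ (ht x hxmem)
        have h1 : ε * (V x + (1 - w x) / ε) < ε * V y :=
          mul_lt_mul_of_pos_left (not_le.1 hy) hε
        rw [mul_add, mul_div_cancel₀ _ hε.ne'] at h1
        simp only [hf]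
        linarith [hw1 y]
    obtain ⟨y, hy, hyt⟩ := exists_mem_eq_of_subharmonic hp hF hsum (B := insert o B) (f := f)
      (fun y hy => by
        rw [Set.mem_insert_iff, not_or] at hy
        have h1 := mul_le_mul_of_nonneg_left (hVB y hy.2) hε.le
        have h2 : ∑ z ∈ F y, p y z * f z
            = ∑ z ∈ F y, p y z * w z - ε * ∑ z ∈ F y, p y z * V z := by
          rw [Finset.mul_sum, ← Finset.sum_sub_distrib]
          exact Finset.sum_congr rfl fun z _ => by simp only [hf]; ring
        rw [h2, ← hw y hy.1]
        simp only [hf]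
        linarith) htop (Set.mem_insert o B) (hreach t) rfl
    have h1 := htop x
    rw [← hyt] at h1
    have h2 := mul_le_mul_of_nonneg_left (hd y hy) hε.le
    have h3 := hb y hy
    simp only [hf] at h1
    linarith
  have hle : ∀ x, w x ≤ w b := by
    intro x
    have : Tendsto (fun ε : ℝ => w b + ε * (V x - V d)) (𝓝[>] 0) (𝓝 (w b)) := by
      have : Tendsto (fun ε : ℝ => w b + ε * (V x - V d)) (𝓝 0) (𝓝 (w b + 0 * (V x - V d))) :=
        Continuous.tendsto (by fun_prop) _
      simp only [zero_mul, add_zero] at this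
      exact this.mono_left nhdsWithin_le_nhds
    exact ge_of_tendsto this (eventually_mem_nhdsWithin.mono fun ε hε => main ε hε x)
  obtain ⟨y, rfl, hy⟩ := exists_mem_eq_of_subharmonic hp hF hsum (B := {o}) (f := w)
    (fun y hy => (hw y (by simpa using hy)).le) hle rfl (hreach b) rfl
  exact (hle x).trans (by rw [← hy, hwo])

/-- Third-order upper bound for the logarithm near `1`. -/
lemma log_one_add_le {s : ℝ} (hs : |s| ≤ 1 / 2) :
    Real.log (1 + s) ≤ s - s ^ 2 / 2 + 2 * |s| ^ 3 := by
  have h := Real.abs_log_sub_add_sum_range_le (x := -s) (by rw [abs_neg]; linarith) 2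
  simp only [Finset.sum_range_succ, Finset.sum_range_zero, abs_neg, sub_neg_eq_add] at h
  have h2 : |s| ^ (2 + 1) / (1 - |s|) ≤ 2 * |s| ^ 3 := by
    rw [div_le_iff₀ (by linarith)]
    have := mul_nonneg (pow_nonneg (abs_nonneg s) 3) (sub_nonneg.2 hs)
    rw [show (2 + 1 : ℕ) = 3 from rfl]
    linarith
  have h3 := (abs_le.1 (h.trans h2)).2
  norm_num at h3
  linarith

/-- First-order estimate for the logarithm near `1`. -/
lemma abs_log_one_add_sub_le {s : ℝ} (hs : |s| ≤ 1 / 2) :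
    |Real.log (1 + s) - s| ≤ 2 * s ^ 2 := by
  have h := Real.abs_log_sub_add_sum_range_le (x := -s) (by rw [abs_neg]; linarith) 1
  simp only [Finset.sum_range_succ, Finset.sum_range_zero, abs_neg, sub_neg_eq_add] at h
  have h2 : |s| ^ (1 + 1) / (1 - |s|) ≤ 2 * s ^ 2 := by
    rw [div_le_iff₀ (by linarith), ← sq_abs s]
    have := mul_nonneg (pow_nonneg (abs_nonneg s) 2) (sub_nonneg.2 hs)
    rw [show (1 + 1 : ℕ) = 2 from rfl]
    linarith
  have h3 := h.trans h2
  norm_num at h3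
  rwa [neg_add_eq_sub] at h3

/-- Pointwise estimate for the increment of `log ∘ log`. -/
lemma log_log_add_le {q d η : ℝ} (hq : Real.exp 1 ≤ q) (hη : η ≤ 1 / 4) (hd : |d| ≤ η * q) :
    Real.log (Real.log (q + d)) ≤ Real.log (Real.log q)
      + (d / q - (d / q) ^ 2 / 2) / Real.log q - (d / q) ^ 2 / (8 * Real.log q ^ 2)
      + 18 * η ^ 3 / Real.log q := by
  have hq0 : 0 < q := (Real.exp_pos 1).trans_le hq
  set T := Real.log q with hT
  have hT1 : 1 ≤ T := by rwa [hT, Real.le_log_iff_exp_le hq0]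
  have hT0 : 0 < T := by linarith
  set s := d / q with hs
  have hsη : |s| ≤ η := by
    rw [hs, abs_div, abs_of_pos hq0, div_le_iff₀ hq0]; exact hd
  have hη0 : 0 ≤ η := (abs_nonneg s).trans hsη
  have hqd : q + d = q * (1 + s) := by rw [hs]; field_simp
  have hs' := abs_le.1 hsη
  set δ := Real.log (1 + s) with hδ
  have hlog : Real.log (q + d) = T * (1 + δ / T) := by
    rw [hqd, Real.log_mul hq0.ne' (by linarith), ← hT, ← hδ]
    field_simp
  have hδs := abs_log_one_add_sub_le (s := s) (by linarith)
  have hss : s ^ 2 ≤ |s| / 4 := by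
    rw [← sq_abs s]; nlinarith [abs_nonneg s]
  have hδ1 : |δ - s| ≤ |s| / 2 := by linarith
  have hδ2 : |δ| ≤ 3 / 2 * |s| := by
    have := abs_add_le (δ - s) s
    rw [sub_add_cancel] at this
    linarith
  have hδ3 : |s| / 2 ≤ |δ| := by
    have := abs_sub_abs_le_abs_sub s δ
    rw [abs_sub_comm] at this
    linarith
  have hδT : |δ / T| ≤ |δ| := by
    rw [abs_div, abs_of_pos hT0]
    exact div_le_self (abs_nonneg _) hT1
  have hδT2 : |δ / T| ≤ 1 / 2 := by linarith
  have hpos : 0 < 1 + δ / T := by linarith [(abs_le.1 hδT2).1]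
  rw [hlog, Real.log_mul hT0.ne' hpos.ne']
  have h1 := log_one_add_le hδT2
  have h2 := log_one_add_le (s := s) (by linarith)
  rw [← hδ] at h2
  have hs3 : |s| ^ 3 ≤ η ^ 3 := pow_le_pow_left₀ (abs_nonneg _) hsη 3
  have h3 : δ / T ≤ (s - s ^ 2 / 2) / T + 2 * η ^ 3 / T := by
    rw [← add_div]
    gcongr
    linarith
  have h4 : s ^ 2 / (8 * T ^ 2) ≤ (δ / T) ^ 2 / 2 := by
    have : (|s| / 2) ^ 2 ≤ |δ| ^ 2 := pow_le_pow_left₀ (by positivity) hδ3 2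
    rw [div_pow, sq_abs, sq_abs] at this
    have e : s ^ 2 / (8 * T ^ 2) = s ^ 2 / 2 ^ 2 / (2 * T ^ 2) := by
      rw [div_div]; ring_nf
    rw [e, div_pow δ T, div_div (δ ^ 2), mul_comm (T ^ 2)]
    gcongr
  have h5 : 2 * |δ / T| ^ 3 ≤ 16 * η ^ 3 / T := by
    have e1 : |δ| ^ 3 ≤ 8 * η ^ 3 := by
      have : |δ| ^ 3 ≤ (2 * η) ^ 3 :=
        pow_le_pow_left₀ (abs_nonneg _) (by linarith) 3
      linarith [this, (by ring : (2 * η) ^ 3 = 8 * η ^ 3)]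
    rw [abs_div, abs_of_pos hT0, div_pow, le_div_iff₀ hT0]
    have e2 : |δ| ^ 3 / T ^ 3 * T ≤ |δ| ^ 3 := by
      have : |δ| ^ 3 / T ^ 3 * T = |δ| ^ 3 / T ^ 2 := by field_simp
      rw [this]
      exact div_le_self (by positivity) (one_le_pow₀ hT1)
    linarith
  have h6 : 18 * η ^ 3 / T = 2 * η ^ 3 / T + 16 * η ^ 3 / T := by ring
  linarith

/-- `log ∘ log` is superharmonic at large scale for increments with the first two moments of a
squared two-dimensional Bessel process. -/
lemma eventually_sum_log_log_le {ι : Type*} (F : Finset ι) (m : ι → ℝ) (hm : ∀ z ∈ F, 0 ≤ m z)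
    (hm1 : ∑ z ∈ F, m z = 1) {C C' D : ℝ} (hD : 0 < D) :
    ∀ᶠ r : ℝ in atTop, ∀ Δ : ι → ℝ, (∀ z ∈ F, |Δ z| ≤ C * r) → ∑ z ∈ F, m z * Δ z = 2 * D →
      4 * D * r ^ 2 - C' * r ≤ ∑ z ∈ F, m z * Δ z ^ 2 →
      ∑ z ∈ F, m z * Real.log (Real.log (r ^ 2 + Δ z)) ≤ Real.log (Real.log (r ^ 2)) := by
  have hlim : Tendsto (fun r : ℝ => (C' / 2 + 18 * C ^ 3) * (2 * (Real.log r / r))) atTop (𝓝 0) := by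
    have : Tendsto (fun r : ℝ => Real.log r / r) atTop (𝓝 0) := by
      simpa using Real.isLittleO_log_id_atTop.tendsto_div_nhds_zero
    simpa using (this.const_mul 2).const_mul (C' / 2 + 18 * C ^ 3)
  filter_upwards [hlim.eventually_le_const (show 0 < D / 4 by linarith),
    eventually_ge_atTop (2 : ℝ), eventually_ge_atTop (4 * C), eventually_ge_atTop (C' / (2 * D))]
    with r hr hr2 hrC hrC' Δ hΔ hΔ1 hΔ2
  have hr0 : 0 < r := by linarith
  have hexp : Real.exp 1 ≤ r ^ 2 := by nlinarith [Real.exp_one_lt_d9]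
  have hq0 : 0 < r ^ 2 := by positivity
  set T := Real.log (r ^ 2) with hT
  have hTr : T = 2 * Real.log r := by rw [hT, Real.log_pow]; norm_num
  have hT1 : 1 ≤ T := by rwa [hT, Real.le_log_iff_exp_le hq0]
  have hT0 : 0 < T := by linarith
  have hη : C / r ≤ 1 / 4 := by rw [div_le_iff₀ hr0]; linarith
  have hpt : ∀ z ∈ F, m z * Real.log (Real.log (r ^ 2 + Δ z)) ≤
      m z * (Real.log T + 18 * (C / r) ^ 3 / T) + (1 / (r ^ 2 * T)) * (m z * Δ z)
        - (1 / (2 * r ^ 4 * T) + 1 / (8 * r ^ 4 * T ^ 2)) * (m z * Δ z ^ 2) := by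
    intro z hz
    have h := log_log_add_le hexp hη (d := Δ z) (by
      refine (hΔ z hz).trans (le_of_eq ?_)
      field_simp)
    have := mul_le_mul_of_nonneg_left h (hm z hz)
    refine this.trans (le_of_eq ?_)
    rw [← hT]
    field_simp
    ring
  refine (Finset.sum_le_sum hpt).trans ?_
  rw [Finset.sum_sub_distrib, Finset.sum_add_distrib, ← Finset.sum_mul, ← Finset.mul_sum,
    ← Finset.mul_sum, hm1, hΔ1]
  set W := ∑ z ∈ F, m z * Δ z ^ 2
  have hk : 0 ≤ 1 / (2 * r ^ 4 * T) + 1 / (8 * r ^ 4 * T ^ 2) := by positivity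
  have h1 := mul_le_mul_of_nonneg_left hΔ2 hk
  have hsmall : (C' / 2 + 18 * C ^ 3) * T / r ≤ D / 4 := by
    rw [hTr]; refine le_trans (le_of_eq ?_) hr; ring
  have hC'r : C' / r ≤ 2 * D := by
    rw [div_le_iff₀ hr0]; rw [div_le_iff₀ (by positivity)] at hrC'; linarith
  have hgoal : 18 * (C / r) ^ 3 / T + 1 / (r ^ 2 * T) * (2 * D)
      - (1 / (2 * r ^ 4 * T) + 1 / (8 * r ^ 4 * T ^ 2)) * (4 * D * r ^ 2 - C' * r)
      = (1 / (r ^ 2 * T ^ 2)) * ((C' / 2 + 18 * C ^ 3) * T / r - D / 2 + (C' / r) / 8) := by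
    field_simp
    ring
  have h2 : (1 / (r ^ 2 * T ^ 2)) * ((C' / 2 + 18 * C ^ 3) * T / r - D / 2 + (C' / r) / 8) ≤ 0 :=
    mul_nonpos_of_nonneg_of_nonpos (by positivity) (by linarith)
  linarith

/-- Existence of a Lyapunov function for planar random walks with finite support. -/
lemma exists_lyapunov (F : Finset (ℤ × ℤ)) (m : ℤ × ℤ → ℝ) (hm : ∀ z ∈ F, 0 < m z)
    (hm1 : ∑ z ∈ F, m z = 1)
    (h1 : ∑ z ∈ F, m z * (z.1 : ℝ) = 0) (h2 : ∑ z ∈ F, m z * (z.2 : ℝ) = 0) {a b c : ℝ}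
    (ha : ∑ z ∈ F, m z * ((z.1 : ℝ) * z.1) = a) (hb : ∑ z ∈ F, m z * ((z.1 : ℝ) * z.2) = b)
    (hc : ∑ z ∈ F, m z * ((z.2 : ℝ) * z.2) = c) (hdet : a * c - b * b ≠ 0) :
    ∃ V : ℤ × ℤ → ℝ, (∀ t, {x | V x ≤ t}.Finite) ∧
      {x | ¬ ∑ z ∈ F, m z * V (x + z) ≤ V x}.Finite := by
  have ha0 : 0 ≤ a := ha ▸ Finset.sum_nonneg fun z hz => mul_nonneg (hm z hz).le (mul_self_nonneg _)
  have hc0 : 0 ≤ c := hc ▸ Finset.sum_nonneg fun z hz => mul_nonneg (hm z hz).le (mul_self_nonneg _)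
  -- the second moment of a linear functional
  have hmom : ∀ u v : ℝ, ∑ z ∈ F, m z * (u * z.1 + v * z.2) ^ 2
      = u ^ 2 * a + 2 * u * v * b + v ^ 2 * c := by
    intro u v
    rw [← ha, ← hb, ← hc, Finset.mul_sum, Finset.mul_sum, Finset.mul_sum, ← Finset.sum_add_distrib,
      ← Finset.sum_add_distrib]
    exact Finset.sum_congr rfl fun z _ => by ring
  have hmom0 : ∀ u v : ℝ, 0 ≤ u ^ 2 * a + 2 * u * v * b + v ^ 2 * c := fun u v =>
    hmom u v ▸ Finset.sum_nonneg fun z hz => mul_nonneg (hm z hz).le (sq_nonneg _)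
  have hdisc : b * b ≤ a * c := by
    have := discrim_le_zero (a := a) (b := 2 * b) (c := c) fun u => by
      have := hmom0 u 1
      nlinarith
    rw [discrim] at this
    nlinarith
  set D := a * c - b * b with hDdef
  have hD : 0 < D := lt_of_le_of_ne (by linarith) (Ne.symm hdet)
  have hapos : 0 < a := by
    refine lt_of_le_of_ne ha0 fun h => ?_
    rw [hDdef, ← h] at hD
    nlinarith [mul_self_nonneg b]
  have hcpos : 0 < c := by
    refine lt_of_le_of_ne hc0 fun h => ?_
    rw [hDdef, ← h] at hD
    nlinarith [mul_self_nonneg b]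
  -- the adjugate quadratic form and its polarization
  set q : ℤ × ℤ → ℝ := fun x => c * (x.1 : ℝ) ^ 2 - 2 * b * x.1 * x.2 + a * (x.2 : ℝ) ^ 2 with hq
  set L : ℤ × ℤ → ℤ × ℤ → ℝ := fun x z =>
    (c * x.1 - b * x.2) * z.1 + (a * x.2 - b * x.1) * z.2 with hL
  have hqadd : ∀ x z, q (x + z) = q x + (2 * L x z + q z) := by
    intro x z
    simp only [hq, hL, Prod.fst_add, Prod.snd_add]
    push_cast
    ring
  have hcs : ∀ x z, L x z ^ 2 ≤ q x * q z := by
    intro x z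
    have : q x * q z - L x z ^ 2 = D * ((x.1 : ℝ) * z.2 - x.2 * z.1) ^ 2 := by
      simp only [hq, hL, hDdef]
      ring
    have h3 : 0 ≤ D * ((x.1 : ℝ) * z.2 - x.2 * z.1) ^ 2 := by positivity
    linarith
  have hqx : ∀ x, D * (x.1 : ℝ) ^ 2 ≤ a * q x := by
    intro x
    have : a * q x = D * (x.1 : ℝ) ^ 2 + (b * x.1 - a * x.2) ^ 2 := by
      simp only [hq, hDdef]
      ring
    nlinarith [sq_nonneg (b * (x.1 : ℝ) - a * x.2)]
  have hqy : ∀ x, D * (x.2 : ℝ) ^ 2 ≤ c * q x := by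
    intro x
    have : c * q x = D * (x.2 : ℝ) ^ 2 + (c * x.1 - b * x.2) ^ 2 := by
      simp only [hq, hDdef]
      ring
    nlinarith [sq_nonneg (c * (x.1 : ℝ) - b * x.2)]
  have hq0 : ∀ x, 0 ≤ q x := by
    intro x
    have h3 : 0 ≤ D * (x.1 : ℝ) ^ 2 := by positivity
    exact nonneg_of_mul_nonneg_right (h3.trans (hqx x)) hapos
  have hfin : ∀ t, {x | q x ≤ t}.Finite := by
    intro t
    have key : ∀ (n : ℤ) (e : ℝ), D * (n : ℝ) ^ 2 ≤ e → |n| ≤ ⌈e / D⌉ := by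
      intro n e h
      have h3 : (n : ℝ) ^ 2 ≤ e / D := by rw [le_div_iff₀ hD]; linarith
      have h4 : (|n| : ℝ) ≤ (n : ℝ) ^ 2 := by
        rw [← sq_abs]
        exact_mod_cast Int.le_self_sq |n|
      have : ((|n| : ℤ) : ℝ) ≤ ⌈e / D⌉ := by push_cast; exact (h4.trans h3).trans (Int.le_ceil _)
      exact_mod_cast this
    refine Set.Finite.subset ((Set.finite_Icc (-⌈a * t / D⌉) ⌈a * t / D⌉).prod
      (Set.finite_Icc (-⌈c * t / D⌉) ⌈c * t / D⌉)) fun x (hx : q x ≤ t) => ?_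
    exact ⟨abs_le.1 (key _ _ ((hqx x).trans (by gcongr))),
      abs_le.1 (key _ _ ((hqy x).trans (by gcongr)))⟩
  obtain ⟨k, hk0, hk⟩ : ∃ k, 0 ≤ k ∧ ∀ z ∈ F, q z ≤ k :=
    ⟨∑ z ∈ F, q z, Finset.sum_nonneg fun z _ => hq0 z,
      fun z hz => Finset.single_le_sum (fun z _ => hq0 z) hz⟩
  have hLbound : ∀ x, ∀ z ∈ F, |L x z| ≤ √(q x) * √k := by
    intro x z hz
    rw [← Real.sqrt_mul (hq0 x)]
    exact Real.abs_le_sqrt ((hcs x z).trans (mul_le_mul_of_nonneg_left (hk z hz) (hq0 x)))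
  refine ⟨fun x => Real.log (Real.log (q x)), fun t => ?_, ?_⟩
  · have hlim : Tendsto (fun r : ℝ => Real.log (Real.log r)) atTop atTop :=
      Real.tendsto_log_atTop.comp Real.tendsto_log_atTop
    obtain ⟨r, hr⟩ := eventually_atTop.1 (hlim.eventually_gt_atTop t)
    refine (hfin r).subset fun x (hx : Real.log (Real.log (q x)) ≤ t) => ?_
    by_contra hxr
    exact absurd hx (not_le.2 (hr _ (not_le.1 hxr).le))
  · have hev := eventually_sum_log_log_le F m (fun z hz => (hm z hz).le) hm1
      (C := 2 * √k + k) (C' := 4 * (√k * k)) hD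
    obtain ⟨r, hr⟩ := eventually_atTop.1 ((Real.tendsto_sqrt_atTop.eventually hev).and
      (eventually_ge_atTop 1))
    refine (hfin r).subset fun x hx => ?_
    by_contra hxr
    obtain ⟨hr1, hr2⟩ := hr (q x) (not_le.1 hxr).le
    have hs1 : 1 ≤ √(q x) := Real.one_le_sqrt.2 hr2
    have hsq : √(q x) ^ 2 = q x := Real.sq_sqrt (hq0 x)
    refine hx ?_
    have := hr1 (fun z => 2 * L x z + q z) ?_ ?_ ?_
    · rw [hsq] at this
      simpa only [hqadd] using this
    · intro z hz
      have e1 := hLbound x z hz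
      have e2 : |q z| ≤ k := by rw [abs_of_nonneg (hq0 z)]; exact hk z hz
      have e3 : k ≤ k * √(q x) := le_mul_of_one_le_right hk0 hs1
      have e4 := abs_add_le (2 * L x z) (q z)
      rw [abs_mul, abs_two] at e4
      linarith
    · have : ∑ z ∈ F, m z * (2 * L x z + q z)
          = 2 * (c * x.1 - b * x.2) * ∑ z ∈ F, m z * (z.1 : ℝ)
            + 2 * (a * x.2 - b * x.1) * ∑ z ∈ F, m z * (z.2 : ℝ)
            + c * ∑ z ∈ F, m z * ((z.1 : ℝ) * z.1) - 2 * b * ∑ z ∈ F, m z * ((z.1 : ℝ) * z.2)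
            + a * ∑ z ∈ F, m z * ((z.2 : ℝ) * z.2) := by
        simp only [Finset.mul_sum, ← Finset.sum_add_distrib, ← Finset.sum_sub_distrib]
        exact Finset.sum_congr rfl fun z _ => by simp only [hq, hL]; ring
      rw [this, h1, h2, ha, hb, hc]
      ring
    · have hLsum : ∑ z ∈ F, m z * L x z ^ 2 = D * q x := by
        simp only [hL, hmom, hq, hDdef]
        ring
      have hterm : ∀ z ∈ F, 4 * (m z * L x z ^ 2) - m z * (4 * (√k * k) * √(q x))
          ≤ m z * (2 * L x z + q z) ^ 2 := by
        intro z hz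
        have e2 : -(√(q x) * √k * k) ≤ L x z * q z := by
          have : |L x z * q z| ≤ √(q x) * √k * k := by
            rw [abs_mul, abs_of_nonneg (hq0 z)]
            exact mul_le_mul (hLbound x z hz) (hk z hz) (hq0 z) (by positivity)
          exact neg_le_of_abs_le this
        have e3 : 4 * L x z ^ 2 - 4 * (√k * k) * √(q x) ≤ (2 * L x z + q z) ^ 2 := by
          nlinarith [sq_nonneg (q z)]
        have := mul_le_mul_of_nonneg_left e3 (hm z hz).le
        linarith
      have := Finset.sum_le_sum hterm
      rw [Finset.sum_sub_distrib, ← Finset.mul_sum, ← Finset.sum_mul, hLsum, hm1] at this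
      rw [hsq]
      linarith

/-- The probability that the chain with transition weights `p`, started at `x`, avoids `o` during
the first `k` steps. -/
noncomputable def avoidProb {X : Type*} [DecidableEq X] (p : X → X → ℝ) (F : X → Finset X) (o : X) :
    ℕ → X → ℝ
  | 0, _ => 1
  | k + 1, x => ∑ y ∈ F x, p x y * if y = o then 0 else avoidProb p F o k y

lemma avoidProb_nonneg {X : Type*} [DecidableEq X] {p : X → X → ℝ} {F : X → Finset X} {o : X}
    (hp : ∀ x y, 0 ≤ p x y) (k : ℕ) (x : X) : 0 ≤ avoidProb p F o k x := by
  induction k generalizing x with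
  | zero => exact zero_le_one
  | succ k ih =>
    refine Finset.sum_nonneg fun y _ => mul_nonneg (hp x y) ?_
    split_ifs
    exacts [le_rfl, ih y]

lemma avoidProb_succ_le {X : Type*} [DecidableEq X] {p : X → X → ℝ} {F : X → Finset X} {o : X}
    (hp : ∀ x y, 0 ≤ p x y) (hsum : ∀ x, ∑ y ∈ F x, p x y = 1) (k : ℕ) (x : X) :
    avoidProb p F o (k + 1) x ≤ avoidProb p F o k x := by
  induction k generalizing x with
  | zero =>
    rw [avoidProb, avoidProb, ← hsum x]
    refine Finset.sum_le_sum fun y _ => mul_le_of_le_one_right (hp x y) ?_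
    split_ifs
    exacts [zero_le_one, le_rfl]
  | succ k ih =>
    rw [avoidProb, avoidProb]
    refine Finset.sum_le_sum fun y _ => mul_le_mul_of_nonneg_left ?_ (hp x y)
    split_ifs
    exacts [le_rfl, ih y]

/-- Foster criterion: an irreducible chain with a Lyapunov function hits `o` almost surely. -/
lemma tendsto_avoidProb {X : Type*} [DecidableEq X] {p : X → X → ℝ} {F : X → Finset X}
    (hp : ∀ x y, 0 ≤ p x y) (hF : ∀ x y, 0 < p x y → y ∈ F x) (hsum : ∀ x, ∑ y ∈ F x, p x y = 1)
    {o : X} (hreach : ∀ x, Relation.ReflTransGen (fun a b => 0 < p a b) x o)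
    {V : X → ℝ} (hV : ∀ c, {x | V x ≤ c}.Finite) {B : Set X} (hB : B.Finite)
    (hVB : ∀ x ∉ B, ∑ y ∈ F x, p x y * V y ≤ V x) (x : X) :
    Tendsto (fun k => avoidProb p F o k x) atTop (𝓝 0) := by
  have hlim : ∀ x, ∃ v, Tendsto (fun k => avoidProb p F o k x) atTop (𝓝 v) := fun x =>
    ⟨_, tendsto_atTop_ciInf (antitone_nat_of_succ_le fun k => avoidProb_succ_le hp hsum k x)
      ⟨0, by rintro _ ⟨k, rfl⟩; exact avoidProb_nonneg hp k x⟩⟩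
  choose v hv using hlim
  have hv0 : ∀ x, 0 ≤ v x := fun x => ge_of_tendsto' (hv x) fun k => avoidProb_nonneg hp k x
  have hv1 : ∀ x, v x ≤ 1 := fun x => le_of_tendsto' (hv x) fun k =>
    antitone_nat_of_succ_le (f := fun k => avoidProb p F o k x)
      (fun k => avoidProb_succ_le hp hsum k x) (Nat.zero_le k)
  set w : X → ℝ := fun y => if y = o then 0 else v y with hw
  have hharm : ∀ x, v x = ∑ y ∈ F x, p x y * w y := by
    intro x
    refine tendsto_nhds_unique ((hv x).comp (tendsto_add_atTop_nat 1)) ?_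
    refine tendsto_finsetSum _ fun y _ => Tendsto.const_mul _ ?_
    by_cases hy : y = o
    · simp [hw, hy]
    · simpa [hw, hy] using hv y
  have hwle : ∀ x, w x ≤ 0 := by
    refine nonpos_of_harmonic_off hp hF hsum hreach hV hB hVB (fun x => ?_) (by simp [hw])
      (fun x hx => by rw [← hharm x]; simp [hw, hx])
    simp only [hw]
    split_ifs
    exacts [zero_le_one, hv1 x]
  have : v x = 0 := by
    refine le_antisymm ?_ (hv0 x)
    rw [hharm x]
    exact Finset.sum_nonpos fun y _ => mul_nonpos_of_nonneg_of_nonpos (hp x y) (hwle y)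
  exact this ▸ hv x

/-- The conditional probability, given a history, of avoiding `o` for `k` more steps. -/
lemma measure_prefixEvent_inter_avoid_le {Ω : Type*} [MeasurableSpace Ω] {P : Measure Ω}
    {p : ℤ × ℤ → ℤ × ℤ → ℝ} {F : ℤ × ℤ → Finset (ℤ × ℤ)} (hp : ∀ x y, 0 ≤ p x y)
    (hF : ∀ x y, 0 < p x y → y ∈ F x) {S : ℕ → Ω → ℤ × ℤ} {o : ℤ × ℤ}
    (hM : ∀ (n : ℕ) (h : ℕ → ℤ × ℤ) (y : ℤ × ℤ), P ({ω | S (n + 1) ω = y} ∩ prefixEvent S n h)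
      = ENNReal.ofReal (p (h n) y) * P (prefixEvent S n h)) (k n : ℕ) (h : ℕ → ℤ × ℤ) :
    P (prefixEvent S n h ∩ {ω | ∀ j, n < j → j ≤ n + k → S j ω ≠ o})
      ≤ ENNReal.ofReal (avoidProb p F o k (h n)) * P (prefixEvent S n h) := by
  induction k generalizing n h with
  | zero => simpa [avoidProb] using measure_mono Set.inter_subset_left
  | succ k ih =>
    set g : ℤ × ℤ → ℕ → ℤ × ℤ := fun y => Function.update h (n + 1) y with hg
    have hgn : ∀ y, ∀ i ≤ n, g y i = h i := fun y i hi =>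
      Function.update_of_ne (by omega) _ _
    have hpre : ∀ y, prefixEvent S (n + 1) (g y)
        = {ω | S (n + 1) ω = y} ∩ prefixEvent S n h := by
      intro y
      ext ω
      constructor
      · intro hω
        exact ⟨by simpa [hg] using hω (n + 1) le_rfl, fun i hi =>
          (hω i (by omega)).trans (hgn y i hi)⟩
      · rintro ⟨h1, h2⟩ i hi
        rcases Nat.le_succ_iff.1 hi with hi | rfl
        · exact (h2 i hi).trans (hgn y i hi).symm
        · simpa [hg] using h1
    have hcov : prefixEvent S n h ∩ {ω | ∀ j, n < j → j ≤ n + (k + 1) → S j ω ≠ o} ⊆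
        ⋃ y, if y = o then ∅ else prefixEvent S (n + 1) (g y) ∩
          {ω | ∀ j, n + 1 < j → j ≤ n + 1 + k → S j ω ≠ o} := by
      rintro ω ⟨h1, h2⟩
      refine Set.mem_iUnion.2 ⟨S (n + 1) ω, ?_⟩
      rw [if_neg (h2 (n + 1) (by omega) (by omega)), hpre]
      exact ⟨⟨rfl, h1⟩, fun j hj hj' => h2 j (by omega) (by omega)⟩
    have hterm : ∀ y, P (if y = o then ∅ else prefixEvent S (n + 1) (g y) ∩
        {ω | ∀ j, n + 1 < j → j ≤ n + 1 + k → S j ω ≠ o}) ≤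
        ENNReal.ofReal (p (h n) y * if y = o then 0 else avoidProb p F o k y)
          * P (prefixEvent S n h) := by
      intro y
      split_ifs with hy
      · simp
      · refine (ih (n + 1) (g y)).trans (le_of_eq ?_)
        rw [hpre, hM, ← mul_assoc, ← ENNReal.ofReal_mul (avoidProb_nonneg hp _ _)]
        simp [hg, mul_comm]
    calc _ ≤ _ := measure_mono hcov
      _ ≤ _ := measure_iUnion_le _
      _ ≤ _ := ENNReal.tsum_le_tsum hterm
      _ = _ := by
        rw [ENNReal.tsum_mul_right, tsum_eq_sum (s := F (h n)), avoidProb,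
          ENNReal.ofReal_sum_of_nonneg]
        · intro y _
          refine mul_nonneg (hp _ _) ?_
          split_ifs
          exacts [le_rfl, avoidProb_nonneg hp _ _]
        · intro y hy
          have : p (h n) y = 0 := le_antisymm (not_lt.1 fun h' => hy (hF _ _ h')) (hp _ _)
          simp [this]

lemma ae_infinite_of_tendsto_avoidProb {Ω : Type*} [MeasurableSpace Ω] {P : Measure Ω}
    [IsFiniteMeasure P]
    {p : ℤ × ℤ → ℤ × ℤ → ℝ} {F : ℤ × ℤ → Finset (ℤ × ℤ)} (hp : ∀ x y, 0 ≤ p x y)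
    (hF : ∀ x y, 0 < p x y → y ∈ F x) {S : ℕ → Ω → ℤ × ℤ} {o : ℤ × ℤ}
    (hM : ∀ (n : ℕ) (h : ℕ → ℤ × ℤ) (y : ℤ × ℤ), P ({ω | S (n + 1) ω = y} ∩ prefixEvent S n h)
      = ENNReal.ofReal (p (h n) y) * P (prefixEvent S n h))
    (hlim : ∀ x, Tendsto (fun k => avoidProb p F o k x) atTop (𝓝 0)) :
    ∀ᵐ ω ∂P, {n : ℕ | S n ω = o}.Infinite := by
  have hnull : ∀ n h, P (prefixEvent S n h ∩ {ω | ∀ j, n < j → S j ω ≠ o}) = 0 := by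
    intro n h
    have hle : ∀ k, P (prefixEvent S n h ∩ {ω | ∀ j, n < j → S j ω ≠ o})
        ≤ ENNReal.ofReal (avoidProb p F o k (h n)) * P (prefixEvent S n h) := by
      intro k
      refine le_trans (measure_mono ?_) (measure_prefixEvent_inter_avoid_le hp hF hM k n h)
      exact fun ω hω => ⟨hω.1, fun j hj _ => hω.2 j hj⟩
    have ht : Tendsto (fun k => ENNReal.ofReal (avoidProb p F o k (h n)) * P (prefixEvent S n h))
        atTop (𝓝 0) := by
      have := ENNReal.Tendsto.mul_const (b := P (prefixEvent S n h))
        (ENNReal.tendsto_ofReal (hlim (h n))) (Or.inr (measure_ne_top _ _))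
      simpa using this
    exact le_antisymm (ge_of_tendsto' ht hle) zero_le
  set ext : (n : ℕ) → (Fin (n + 1) → ℤ × ℤ) → ℕ → ℤ × ℤ := fun n g i =>
    if hi : i < n + 1 then g ⟨i, hi⟩ else 0 with hext
  have hall : ∀ᵐ ω ∂P, ∀ n : ℕ, ∀ g : Fin (n + 1) → ℤ × ℤ,
      ω ∉ prefixEvent S n (ext n g) ∩ {ω | ∀ j, n < j → S j ω ≠ o} := by
    rw [ae_all_iff]
    intro n
    rw [ae_all_iff]
    exact fun g => measure_eq_zero_iff_ae_notMem.1 (hnull n _)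
  filter_upwards [hall] with ω hω
  refine Set.infinite_of_forall_exists_gt fun n => ?_
  by_contra! hcon
  refine hω n (fun i => S i ω) ⟨fun i hi => ?_, fun j hj hjo => ?_⟩
  · simp only [hext, dif_pos (Nat.lt_succ_of_le hi)]
  · exact absurd hj (not_lt.2 (hcon j hjo))

lemma integral_eq_sum_of_finite_support {μ : Measure (ℤ × ℤ)} [IsFiniteMeasure μ]
    {F : Finset (ℤ × ℤ)} (hF : ∀ z, z ∉ F → μ {z} = 0) (f : ℤ × ℤ → ℝ) :
    ∫ x, f x ∂μ = ∑ z ∈ F, μ.real {z} * f z := by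
  have h0 : μ (F : Set (ℤ × ℤ))ᶜ = 0 :=
    (measure_null_iff_singleton (Set.to_countable _)).2 fun z hz => hF z (by simpa using hz)
  have hr : μ.restrict (F : Set (ℤ × ℤ)) = μ := Measure.restrict_eq_self_of_ae_mem
    (by rw [ae_iff]; exact h0)
  conv_lhs => rw [← hr]
  rw [setIntegral_finset _ IntegrableOn.finset]
  simp only [smul_eq_mul]

lemma finite_setOf_norm_embed_sub_le (x : ℤ × ℤ) (R : ℝ) :
    {y | ‖embed y - embed x‖ ≤ R}.Finite := by
  refine Set.Finite.subset ((Set.finite_Icc (x.1 - ⌈R⌉) (x.1 + ⌈R⌉)).prod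
    (Set.finite_Icc (x.2 - ⌈R⌉) (x.2 + ⌈R⌉))) fun y (hy : ‖embed y - embed x‖ ≤ R) => ?_
  have key : ∀ s t : ℤ, |(s : ℝ) - t| ≤ R → s ∈ Set.Icc (t - ⌈R⌉) (t + ⌈R⌉) := by
    intro s t h
    have : |s - t| ≤ ⌈R⌉ := by exact_mod_cast h.trans (Int.le_ceil R)
    rw [abs_le] at this
    exact ⟨by linarith, by linarith⟩
  exact ⟨key _ _ ((norm_fst_le _).trans hy), key _ _ ((norm_snd_le _).trans hy)⟩


/-- **Recurrence of locally perturbed translation-invariant random walks on `ℤ²`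
with bounded jumps** (cf. Lenci; Szász–Telcs).  The step distribution `μstep` has
bounded (finite) support generating `ℤ²` as a group, mean zero and nondegenerate
covariance matrix.  The Markov chain `S` starts at the origin, moves with
translation-invariant transition probabilities `μstep (y - x)` from every site `x`
outside the finite set `A`, and from sites of `A` moves with arbitrary transition
probabilities `K x ·` subject to bounded jumps, a uniform positive lower bound on
nonzero transition probabilities, and the support condition.  Then almost surely
`S n = (0,0)` for infinitely many `n`. -/
theorem locally_perturbed_rw_recurrent
    {Ω : Type*} [MeasurableSpace Ω] (P : Measure Ω) [IsProbabilityMeasure P]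
    (μstep : Measure (ℤ × ℤ)) [IsProbabilityMeasure μstep]
    -- bounded support
    (hsupp : {x : ℤ × ℤ | μstep {x} ≠ 0}.Finite)
    -- the support generates ℤ² as a group
    (hgen : AddSubgroup.closure {x : ℤ × ℤ | μstep {x} ≠ 0} = ⊤)
    -- mean zero
    (hmean : ∀ i : Fin 2, ∫ x, coordRV i x ∂μstep = 0)
    -- nondegenerate covariance matrix
    (covMat : Matrix (Fin 2) (Fin 2) ℝ)
    (hCov : ∀ i j : Fin 2, covMat i j = ∫ x, coordRV i x * coordRV j x ∂μstep)
    (hCovNd : IsUnit covMat.det)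
    -- the finite perturbation set and the perturbed transition probabilities
    (A : Set (ℤ × ℤ)) (hA : A.Finite)
    (K : ℤ × ℤ → ℤ × ℤ → ℝ≥0∞) (hK : ∀ x ∈ A, ∑' y, K x y = 1)
    -- bounded jumps from A
    (hbound : ∃ R : ℝ, ∀ x ∈ A, ∀ y, K x y ≠ 0 → ‖embed y - embed x‖ ≤ R)
    -- uniform positive lower bound on nonzero transition probabilities from A
    (hδ : ∃ δ : ℝ≥0∞, 0 < δ ∧ ∀ x ∈ A, ∀ y, K x y ≠ 0 → δ ≤ K x y)
    -- support of μstep is contained in the support of the transition law from A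
    (hsuppA : ∀ x ∈ A, ∀ z : ℤ × ℤ, μstep {z} ≠ 0 → K x (x + z) ≠ 0)
    -- the Markov chain
    (S : ℕ → Ω → ℤ × ℤ)
    (hmeas : ∀ n, Measurable (S n))
    (hS0 : ∀ᵐ ω ∂P, S 0 ω = (0, 0))
    (hMarkov : ∀ (n : ℕ) (h : ℕ → ℤ × ℤ), h n ∉ A → ∀ y : ℤ × ℤ,
      P ({ω | S (n + 1) ω = y} ∩ prefixEvent S n h)
        = μstep {y - h n} * P (prefixEvent S n h))
    (hMarkovA : ∀ (n : ℕ) (h : ℕ → ℤ × ℤ), h n ∈ A → ∀ y : ℤ × ℤ,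
      P ({ω | S (n + 1) ω = y} ∩ prefixEvent S n h)
        = K (h n) y * P (prefixEvent S n h)) :
    ∀ᵐ ω ∂P, {n : ℕ | S n ω = (0, 0)}.Infinite := by
  classical
  set F : Finset (ℤ × ℤ) := hsupp.toFinset with hFdef
  have hFmem : ∀ z, z ∈ F ↔ μstep {z} ≠ 0 := fun z => by simp [hFdef]
  have hFcoe : (F : Set (ℤ × ℤ)) = {x : ℤ × ℤ | μstep {x} ≠ 0} := by simp [hFdef]
  have hF0 : ∀ z, z ∉ F → μstep {z} = 0 := fun z hz => by
    by_contra h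
    exact hz ((hFmem z).2 h)
  have hint := integral_eq_sum_of_finite_support hF0
  have hmpos : ∀ z ∈ F, 0 < μstep.real {z} := fun z hz =>
    ENNReal.toReal_pos ((hFmem z).1 hz) (measure_ne_top _ _)
  have hm1 : ∑ z ∈ F, μstep.real {z} = 1 := by
    have := hint fun _ => 1
    simpa using this.symm
  have h1 : ∑ z ∈ F, μstep.real {z} * (z.1 : ℝ) = 0 := by
    rw [← hint fun z => (z.1 : ℝ)]
    simpa [coordRV] using hmean 0
  have h2 : ∑ z ∈ F, μstep.real {z} * (z.2 : ℝ) = 0 := by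
    rw [← hint fun z => (z.2 : ℝ)]
    simpa [coordRV] using hmean 1
  have hdet : covMat 0 0 * covMat 1 1 - covMat 0 1 * covMat 0 1 ≠ 0 := by
    have h10 : covMat 1 0 = covMat 0 1 := by
      rw [hCov, hCov]
      simp only [mul_comm]
    have := hCovNd.ne_zero
    rwa [Matrix.det_fin_two, h10] at this
  obtain ⟨V, hV, hVB⟩ := exists_lyapunov F (fun z => μstep.real {z}) hmpos hm1 h1 h2
    (a := covMat 0 0) (b := covMat 0 1) (c := covMat 1 1)
    (by rw [hCov, hint]; simp [coordRV]) (by rw [hCov, hint]; simp [coordRV])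
    (by rw [hCov, hint]; simp [coordRV]) hdet
  have hKtop : ∀ x ∈ A, ∀ y, K x y ≠ ∞ := fun x hx y =>
    ne_top_of_le_ne_top ENNReal.one_ne_top ((ENNReal.le_tsum y).trans (hK x hx).le)
  obtain ⟨R, hR⟩ := hbound
  set G : ℤ × ℤ → Finset (ℤ × ℤ) := fun x =>
    if x ∈ A then (finite_setOf_norm_embed_sub_le x R).toFinset
    else F.map (addLeftEmbedding x) with hG
  set p : ℤ × ℤ → ℤ × ℤ → ℝ := fun x y =>
    if x ∈ A then (K x y).toReal else μstep.real {y - x} with hpdef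
  have hp : ∀ x y, 0 ≤ p x y := by
    intro x y
    simp only [hpdef]
    split_ifs
    exacts [ENNReal.toReal_nonneg, measureReal_nonneg]
  have hpG : ∀ x y, 0 < p x y → y ∈ G x := by
    intro x y hxy
    by_cases hx : x ∈ A
    · simp only [hpdef, hx, if_true] at hxy
      simpa [hG, hx] using hR x hx y fun h => by simp [h] at hxy
    · simp only [hpdef, hx, if_false] at hxy
      simp only [hG, hx, if_false, Finset.mem_map, addLeftEmbedding_apply]
      refine ⟨y - x, (hFmem _).2 fun h => ?_, by abel⟩
      simp [measureReal_def, h] at hxy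
  have hsum : ∀ x, ∑ y ∈ G x, p x y = 1 := by
    intro x
    by_cases hx : x ∈ A
    · simp only [hpdef, hx, if_true]
      rw [← ENNReal.toReal_sum fun y _ => hKtop x hx y, ← tsum_eq_sum (L := .unconditional _), hK x hx,
        ENNReal.toReal_one]
      intro y hy
      by_contra h
      exact hy (by simpa [hG, hx] using hR x hx y h)
    · simpa [hpdef, hG, hx] using hm1
  have hstep : ∀ x, ∀ z ∈ F, 0 < p x (x + z) := by
    intro x z hz
    by_cases hx : x ∈ A
    · simpa only [hpdef, hx, if_true] using
        ENNReal.toReal_pos (hsuppA x hx z ((hFmem z).1 hz)) (hKtop x hx _)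
    · simpa [hpdef, hx] using hmpos z hz
  have htrans : ∀ z ∈ AddSubmonoid.closure (F : Set (ℤ × ℤ)), ∀ x,
      Relation.ReflTransGen (fun a b => 0 < p a b) x (x + z) := by
    intro z hz
    induction hz using AddSubmonoid.closure_induction with
    | mem z hz => exact fun x => .single (hstep x z hz)
    | zero => exact fun x => by rw [add_zero]
    | add y z _ _ ihy ihz =>
      intro x
      rw [← add_assoc]
      exact (ihy x).trans (ihz (x + y))
  have hreach : ∀ x, Relation.ReflTransGen (fun a b => 0 < p a b) x (0, 0) := by
    intro x
    have hmem : -x ∈ AddSubmonoid.closure (F : Set (ℤ × ℤ)) := by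
      rw [addSubmonoid_closure_eq_top F _ hmpos h1 h2 (hFcoe ▸ hgen)]
      trivial
    have := htrans _ hmem x
    rwa [add_neg_cancel] at this
  refine ae_infinite_of_tendsto_avoidProb hp hpG (fun n h y => ?_)
    (tendsto_avoidProb hp hpG hsum hreach hV (hVB.union hA) fun x hx => ?_)
  · by_cases hx : h n ∈ A
    · rw [hMarkovA n h hx]
      simp only [hpdef, hx, if_true]
      rw [ENNReal.ofReal_toReal (hKtop _ hx _)]
    · rw [hMarkov n h hx]
      simp only [hpdef, hx, if_false]
      rw [ofReal_measureReal]
  · rw [Set.mem_union, not_or] at hx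
    have hx' := not_not.1 hx.1
    simpa [hpdef, hG, hx.2] using hx'
end
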